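/- arXiv:2601.03180 — 3 statements merged into one kernel-verified Lean document; each statement's English description precedes it below -/
import Mathlib

section
/- Fix ε with 0 < ε < 1 and let X be an extended metric space. Let Tr(X) be the set of finite ordered binary trees with leaves labelled in X and inner nodes labelled by σ₁ or σ₂, and define d̂_X on Tr(X) by: d̂_X(x,y) = d_X(x,y) for leaves x, y; d̂_X(t,t') = ∞ if exactly one of t, t' is a leaf; and for t = σ_i(t_l, t_r), t' = σ_j(t'_l, t'_r), setting m = max{d̂_X(t_l,t'_l), d̂_X(t_r,t'_r)}, d̂_X(t,t') = m if i = j and d̂_X(t,t') = ε + m if i ≠ j. Then d̂_X is an extended metric on Tr(X), and the two tree-tupling operations σ₁, σ₂ : Tr(X)² → Tr(X) are nonexpanding with respect to the maximum metric on Tr(X)². -/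
open ENNReal

/-- Finite ordered binary trees with leaves labelled in `X` and inner nodes labelled by
one of two symbols `σ₁, σ₂` (encoded by `Bool`: `true` for `σ₁`, `false` for `σ₂`). -/
inductive BTree (X : Type u) : Type u
  | leaf : X → BTree X
  | node : Bool → BTree X → BTree X → BTree X

/-- The metric `d̂_X` on trees: leaf distances are taken from `dX`; `∞` if exactly one
argument is a leaf; and for `t = σ_i (t_l, t_r)`, `t' = σ_j (t'_l, t'_r)` with
`m = max (d̂ t_l t'_l) (d̂ t_r t'_r)`, the distance is `m` if `i = j` and `ε + m`
otherwise. -/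
noncomputable def dHat {X : Type u} (dX : X → X → ℝ≥0∞) (ε : ℝ≥0∞) :
    BTree X → BTree X → ℝ≥0∞
  | .leaf x, .leaf y => dX x y
  | .node i a b, .node j a' b' =>
      (if i = j then 0 else ε) + max (dHat dX ε a a') (dHat dX ε b b')
  | _, _ => ∞

/-- `d` is an extended metric on `X`. -/
def IsEMet {X : Type u} (d : X → X → ℝ≥0∞) : Prop :=
  (∀ x, d x x = 0) ∧ (∀ x y, d x y = 0 → x = y) ∧ (∀ x y, d x y = d y x) ∧
    (∀ x y z, d x z ≤ d x y + d y z)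

theorem dHat_self {X : Type u} {dX : X → X → ℝ≥0∞} (h : ∀ x, dX x x = 0) (ε : ℝ≥0∞)
    (t : BTree X) : dHat dX ε t t = 0 := by
  induction t with
  | leaf x => simpa [dHat] using h x
  | node i a b iha ihb => simp [dHat, iha, ihb]

theorem eq_of_dHat_eq_zero {X : Type u} {dX : X → X → ℝ≥0∞} {ε : ℝ≥0∞} (hε : 0 < ε)
    (h : ∀ x y, dX x y = 0 → x = y) (s t : BTree X) (hst : dHat dX ε s t = 0) : s = t := by
  induction s generalizing t with
  | leaf x =>
    cases t with
    | leaf y => rw [h x y (by simpa [dHat] using hst)]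
    | node j c d => simp [dHat] at hst
  | node i a b iha ihb =>
    cases t with
    | leaf y => simp [dHat] at hst
    | node j c d =>
      simp only [dHat, add_eq_zero, ite_eq_left_iff, hε.ne', imp_false, not_not,
        max_eq_zero] at hst
      obtain ⟨rfl, hac, hbd⟩ := hst
      rw [iha c hac, ihb d hbd]

theorem dHat_comm {X : Type u} {dX : X → X → ℝ≥0∞} (h : ∀ x y, dX x y = dX y x) (ε : ℝ≥0∞)
    (s t : BTree X) : dHat dX ε s t = dHat dX ε t s := by
  induction s generalizing t with
  | leaf x =>
    cases t with
    | leaf y => simpa [dHat] using h x y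
    | node j c d => simp [dHat]
  | node i a b iha ihb =>
    cases t with
    | leaf y => simp [dHat]
    | node j c d => simp only [dHat, iha c, ihb d, eq_comm (a := i)]

theorem dHat_triangle {X : Type u} {dX : X → X → ℝ≥0∞}
    (h : ∀ x y z, dX x z ≤ dX x y + dX y z) (ε : ℝ≥0∞) (s t u : BTree X) :
    dHat dX ε s u ≤ dHat dX ε s t + dHat dX ε t u := by
  induction s generalizing t u with
  | leaf x =>
    cases t <;> cases u <;> simp [dHat, h]
  | node i a b iha ihb =>
    cases t with
    | leaf y => simp [dHat]
    | node j c d =>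
      cases u with
      | leaf z => simp [dHat]
      | node k e f =>
        have hlabel : (if i = k then 0 else ε) ≤
            (if i = j then 0 else ε) + (if j = k then 0 else ε) := by
          cases i <;> cases j <;> cases k <;> simp
        have hmax : max (dHat dX ε a e) (dHat dX ε b f) ≤
            max (dHat dX ε a c) (dHat dX ε b d) + max (dHat dX ε c e) (dHat dX ε d f) :=
          max_le
            ((iha c e).trans (add_le_add (le_max_left _ _) (le_max_left _ _)))
            ((ihb d f).trans (add_le_add (le_max_right _ _) (le_max_right _ _)))
        simp only [dHat]
        rw [add_add_add_comm]
        exact add_le_add hlabel hmax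

/-- For `0 < ε < 1` and an extended metric space `X`, the function `d̂_X`
is an extended metric on the set of binary trees, and the two tree-tupling operations
are nonexpanding with respect to the maximum metric on pairs of trees. -/
theorem dHat_emetric_and_tupling_nonexpanding {X : Type u}
    (dX : X → X → ℝ≥0∞) (hdX : IsEMet dX)
    (ε : ℝ≥0∞) (hε0 : 0 < ε) (hε1 : ε < 1) :
    IsEMet (dHat dX ε) ∧
    ∀ (i : Bool) (a b a' b' : BTree X),
      dHat dX ε (BTree.node i a b) (BTree.node i a' b') ≤
        max (dHat dX ε a a') (dHat dX ε b b') := by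
  obtain ⟨hself, hzero, hcomm, htri⟩ := hdX
  refine ⟨⟨dHat_self hself ε, eq_of_dHat_eq_zero hε0 hzero, dHat_comm hcomm ε,
    dHat_triangle htri ε⟩, fun i a b a' b' => ?_⟩
  simp [dHat]
end

section
/- Fix ε with 0 < ε < 1 and let X be an extended metric space. Then (Tr(X), d̂_X) with the tree-tupling operations σ₁, σ₂ is the free algebra on X in the variety of quantitative algebras with two binary operations satisfying σ₁(x,y) =_ε σ₂(x,y). Precisely: (a) d(σ₁(t,t'), σ₂(t,t')) ≤ ε for all t, t' ∈ Tr(X); (b) the insertion of leaves η : X → Tr(X) is an isometric embedding; and (c) for every extended metric space A with two nonexpanding binary operations σ₁^A, σ₂^A : A² → A (maximum metric on A²) satisfying d(σ₁^A(a,b), σ₂^A(a,b)) ≤ ε for all a, b ∈ A, and every nonexpanding map f : X → A, the unique map f^# : Tr(X) → A with f^# ∘ η = f and f^#(σ_i(t,t')) = σ_i^A(f^#(t), f^#(t')) is nonexpanding with respect to d̂_X. -/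
open ENNReal

/-- The homomorphic extension of `f : X → A` to trees, for two binary operations on `A`. -/
def evalBT {X : Type u} {A : Type v} (opA : Bool → A → A → A) (f : X → A) : BTree X → A
  | .leaf x => f x
  | .node i a b => opA i (evalBT opA f a) (evalBT opA f b)

/-- `(Tr(X), d̂_X)` with the tree-tupling operations is the free algebra on
`X` in the variety of quantitative algebras with two binary operations `σ₁, σ₂`
satisfying `σ₁ (x, y) =_ε σ₂ (x, y)`: (a) the two tuplings of any pair of trees are at
distance at most `ε`; (b) the insertion of leaves is an isometric embedding; (c) for any
such quantitative algebra `A` and nonexpanding `f : X → A`, the unique homomorphic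
extension `f^# : Tr(X) → A` of `f` is nonexpanding with respect to `d̂_X`. -/
theorem tree_algebra_free {X : Type u}
    (dX : X → X → ℝ≥0∞) (hdX : IsEMet dX)
    (ε : ℝ≥0∞) (hε0 : 0 < ε) (hε1 : ε < 1) :
    -- (a) σ₁(t,t') and σ₂(t,t') are ε-close :
    (∀ t t' : BTree X,
      dHat dX ε (BTree.node true t t') (BTree.node false t t') ≤ ε) ∧
    -- (b) the insertion of leaves η : X → Tr(X) is an isometric embedding :
    (∀ x y : X, dHat dX ε (BTree.leaf x) (BTree.leaf y) = dX x y) ∧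
    -- (c) freeness :
    (∀ (A : Type v) (dA : A → A → ℝ≥0∞), IsEMet dA →
      ∀ opA : Bool → A → A → A,
      (∀ (i : Bool) (a b a' b' : A),
        dA (opA i a b) (opA i a' b') ≤ max (dA a a') (dA b b')) →
      (∀ a b : A, dA (opA true a b) (opA false a b) ≤ ε) →
      ∀ f : X → A, (∀ x y : X, dA (f x) (f y) ≤ dX x y) →
      ∀ g : BTree X → A, (∀ x : X, g (BTree.leaf x) = f x) →
        (∀ (i : Bool) (t t' : BTree X), g (BTree.node i t t') = opA i (g t) (g t')) →
        ∀ t t' : BTree X, dA (g t) (g t') ≤ dHat dX ε t t') := by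
  refine ⟨fun t t' => by simp [dHat, dHat_self hdX.1], fun x y => by simp [dHat], ?_⟩
  intro A dA hA opA hop heq f hf g hleaf hnode t
  obtain ⟨hzero, -, hsymm, htri⟩ := hA
  have hclose : ∀ (i j : Bool) (a b : A),
      dA (opA i a b) (opA j a b) ≤ if i = j then 0 else ε := by
    intro i j a b
    cases i <;> cases j
    · simp [hzero]
    · simpa [hsymm (opA false a b)] using heq a b
    · simpa using heq a b
    · simp [hzero]
  induction t with
  | leaf x =>
    intro t'
    cases t' with
    | leaf y => simpa [dHat, hleaf] using hf x y
    | node j a' b' => simp [dHat]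
  | node i a b iha ihb =>
    intro t'
    cases t' with
    | leaf y => simp [dHat]
    | node j a' b' =>
      rw [hnode, hnode, dHat]
      calc dA (opA i (g a) (g b)) (opA j (g a') (g b'))
          ≤ dA (opA i (g a) (g b)) (opA j (g a) (g b)) +
              dA (opA j (g a) (g b)) (opA j (g a') (g b')) := htri _ _ _
        _ ≤ _ := add_le_add (hclose i j _ _)
              ((hop j _ _ _ _).trans (max_le_max (iha a') (ihb b')))
end

section
/- Fix ε with 0 < ε < 1, let X = {a,b} with d(a,b) = 1, and let |X| = {a,b} with the discrete metric d(a,b) = ∞. On the set Tr of binary trees with leaves in {a,b} and inner nodes labelled σ₁ or σ₂, let d = d_X^* ∧ d̂_{|X|} be the meet (via the chain-infimum construction) of the similarity metric d_X^* and the metric d̂_{|X|}, and let d̂_X be the metric built from the distance d(a,b) = 1. Then for the trees t = σ₁(σ₂(a,a), σ₁(b,b)) and t' = σ₁(σ₂(b,b), σ₂(b,b)) one has d̂_X(t,t') = 1 while d(t,t') = ε + 1. Consequently the identity function from (Tr, d̂_X) to (Tr, d) is not nonexpanding. -/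
open ENNReal

/-- The similarity metric `d_X^*` on trees: leaf distances are taken from `dX`, trees with
the same root label get the maximum of the distances of their subtrees, and all other
pairs (trees not of the same shape with the same inner-node labels) are at distance `∞`. -/
noncomputable def dSim {X : Type u} (dX : X → X → ℝ≥0∞) : BTree X → BTree X → ℝ≥0∞
  | .leaf x, .leaf y => dX x y
  | .node i a b, .node j a' b' =>
      if i = j then max (dSim dX a a') (dSim dX b b') else ∞
  | _, _ => ∞

/-- The meet of two extended pseudometrics, via the chain-infimum construction. -/
noncomputable def pmeet {X : Type u} (d' d'' : X → X → ℝ≥0∞) (x y : X) : ℝ≥0∞ :=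
  sInf {r : ℝ≥0∞ | ∃ (n : ℕ) (s : ℕ → X), s 0 = x ∧ s n = y ∧
    r = ∑ i ∈ Finset.range n, min (d' (s i) (s (i + 1))) (d'' (s i) (s (i + 1)))}

/-- The two-point space `{a, b}` is encoded by `Bool` (`a = false`, `b = true`);
`dOne` is the metric with `d (a, b) = 1` and `dDisc` the discrete metric with
`d (a, b) = ∞`. -/
noncomputable def dOne (x y : Bool) : ℝ≥0∞ := if x = y then 0 else 1

noncomputable def dDisc (x y : Bool) : ℝ≥0∞ := if x = y then 0 else ∞

namespace BTree

/-- The word of leaf labels of a tree, read from left to right. -/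
def leaves {X : Type*} : BTree X → List X
  | .leaf x => [x]
  | .node _ l r => l.leaves ++ r.leaves

/-- The shape of a tree together with its inner-node labels, forgetting the leaf labels. -/
def skeleton {X : Type*} : BTree X → BTree Unit
  | .leaf _ => .leaf ()
  | .node i l r => .node i l.skeleton r.skeleton

end BTree

theorem dSim_eq_top_of_skeleton_ne {X : Type*} (d : X → X → ℝ≥0∞) (x y : BTree X)
    (h : x.skeleton ≠ y.skeleton) : dSim d x y = ∞ := by
  induction x generalizing y with
  | leaf x => cases y <;> simp_all [dSim, BTree.skeleton]
  | node i l r ihl ihr =>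
    cases y with
    | leaf y => simp [dSim]
    | node j l' r' =>
      rw [dSim]
      split_ifs with hij
      · by_cases hl : l.skeleton = l'.skeleton
        · rw [ihr r' fun hr => h (by simp [BTree.skeleton, hij, hl, hr]), max_top_right]
        · rw [ihl l' hl, max_top_left]
      · rfl

theorem one_le_dSim_dOne_of_leaves_ne (x y : BTree Bool) (h : x.leaves ≠ y.leaves) :
    1 ≤ dSim dOne x y := by
  induction x generalizing y with
  | leaf x => cases y <;> simp_all [dSim, dOne, BTree.leaves]
  | node i l r ihl ihr =>
    cases y with
    | leaf y => simp [dSim]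
    | node j l' r' =>
      rw [dSim]
      split_ifs with hij
      · by_cases hl : l.leaves = l'.leaves
        · exact le_max_of_le_right (ihr r' fun hr => h (by simp [BTree.leaves, hl, hr]))
        · exact le_max_of_le_left (ihl l' hl)
      · exact le_top

theorem dHat_dDisc_eq_top_of_leaves_ne (ε : ℝ≥0∞) (x y : BTree Bool)
    (h : x.leaves ≠ y.leaves) : dHat dDisc ε x y = ∞ := by
  induction x generalizing y with
  | leaf x => cases y <;> simp_all [dHat, dDisc, BTree.leaves]
  | node i l r ihl ihr =>
    cases y with
    | leaf y => simp [dHat]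
    | node j l' r' =>
      rw [dHat]
      by_cases hl : l.leaves = l'.leaves
      · rw [ihr r' fun hr => h (by simp [BTree.leaves, hl, hr]), max_top_right, add_top]
      · rw [ihl l' hl, max_top_left, add_top]

theorem le_dHat_of_skeleton_ne {X : Type*} (d : X → X → ℝ≥0∞) (ε : ℝ≥0∞) (x y : BTree X)
    (h : x.skeleton ≠ y.skeleton) : ε ≤ dHat d ε x y := by
  induction x generalizing y with
  | leaf x => cases y <;> simp_all [dHat, BTree.skeleton]
  | node i l r ihl ihr =>
    cases y with
    | leaf y => simp [dHat]
    | node j l' r' =>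
      rw [dHat]
      split_ifs with hij
      · rw [zero_add]
        by_cases hl : l.skeleton = l'.skeleton
        · exact le_max_of_le_right
            (ihr r' fun hr => h (by simp [BTree.skeleton, hij, hl, hr]))
        · exact le_max_of_le_left (ihl l' hl)
      · exact le_self_add

/-- A pseudometric below both `d'` and `d''` is below their meet. -/
theorem le_pmeet {X : Type*} {d d' d'' : X → X → ℝ≥0∞} (hself : ∀ x, d x x = 0)
    (htri : ∀ x y z, d x z ≤ d x y + d y z) (h' : ∀ x y, d x y ≤ d' x y)
    (h'' : ∀ x y, d x y ≤ d'' x y) (x y : X) : d x y ≤ pmeet d' d'' x y := by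
  refine le_sInf ?_
  rintro _ ⟨n, s, rfl, rfl, rfl⟩
  induction n with
  | zero => simp [hself]
  | succ n ih =>
    rw [Finset.sum_range_succ]
    exact (htri _ (s n) _).trans (add_le_add ih (le_min (h' _ _) (h'' _ _)))

theorem pmeet_le_add {X : Type*} (d' d'' : X → X → ℝ≥0∞) (x y z : X) :
    pmeet d' d'' x z ≤ d' x y + d'' y z := by
  rw [pmeet]
  refine sInf_le_of_le ⟨2, fun | 0 => x | 1 => y | _ => z, rfl, rfl, rfl⟩ ?_
  simp only [Finset.sum_range_succ, Finset.sum_range_zero, zero_add]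
  exact add_le_add (min_le_left _ _) (min_le_right _ _)

theorem ite_eq_zero_triangle {Y : Type*} [DecidableEq Y] (c : ℝ≥0∞) (x y z : Y) :
    (if x = z then 0 else c) ≤ (if x = y then 0 else c) + (if y = z then 0 else c) := by
  by_cases hxy : x = y
  · simp [hxy]
  · simpa only [if_neg hxy] using (by split_ifs <;> simp)

open Classical in
/-- Changing the leaves of a tree costs at least `1` and changing its inner nodes at least `ε`
in the meet of the similarity metric and the discrete version of `d̂`. -/
theorem skeleton_add_leaves_le_pmeet (ε : ℝ≥0∞) (x y : BTree Bool) :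
    (if x.skeleton = y.skeleton then 0 else ε) + (if x.leaves = y.leaves then 0 else 1) ≤
      pmeet (dSim dOne) (dHat dDisc ε) x y := by
  refine le_pmeet (d := fun x y : BTree Bool =>
    (if x.skeleton = y.skeleton then 0 else ε) + (if x.leaves = y.leaves then 0 else 1))
    (fun x => by simp) (fun x y z => ?_) (fun x y => ?_) (fun x y => ?_) x y
  · exact (add_le_add (ite_eq_zero_triangle ε _ y.skeleton _)
      (ite_eq_zero_triangle 1 _ y.leaves _)).trans_eq (add_add_add_comm _ _ _ _)
  · by_cases hs : x.skeleton = y.skeleton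
    · by_cases hl : x.leaves = y.leaves
      · simp [hs, hl]
      · simpa [hs, hl] using one_le_dSim_dOne_of_leaves_ne x y hl
    · simp [dSim_eq_top_of_skeleton_ne dOne x y hs]
  · by_cases hl : x.leaves = y.leaves
    · by_cases hs : x.skeleton = y.skeleton
      · simp [hs, hl]
      · simpa [hs, hl] using le_dHat_of_skeleton_ne dDisc ε x y hs
    · simp [dHat_dDisc_eq_top_of_leaves_ne ε x y hl]

/-- For `X = {a, b}` with `d (a, b) = 1` (`a = false`, `b = true`),
`|X| = {a, b}` discrete, and `d = d_X^* ∧ d̂_{|X|}` on trees: for the trees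
`t = σ₁ (σ₂ (a, a), σ₁ (b, b))` and `t' = σ₁ (σ₂ (b, b), σ₂ (b, b))` one has
`d̂_X (t, t') = 1` while `d (t, t') = ε + 1`; consequently the identity from
`(Tr, d̂_X)` to `(Tr, d)` is not nonexpanding. -/
theorem counterexample_not_strongly_finitary (ε : ℝ≥0∞) (hε0 : 0 < ε) (hε1 : ε < 1) :
    dHat dOne ε
        (BTree.node true (BTree.node false (BTree.leaf false) (BTree.leaf false))
          (BTree.node true (BTree.leaf true) (BTree.leaf true)))
        (BTree.node true (BTree.node false (BTree.leaf true) (BTree.leaf true))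
          (BTree.node false (BTree.leaf true) (BTree.leaf true))) = 1 ∧
    pmeet (dSim dOne) (dHat dDisc ε)
        (BTree.node true (BTree.node false (BTree.leaf false) (BTree.leaf false))
          (BTree.node true (BTree.leaf true) (BTree.leaf true)))
        (BTree.node true (BTree.node false (BTree.leaf true) (BTree.leaf true))
          (BTree.node false (BTree.leaf true) (BTree.leaf true))) = ε + 1 ∧
    ¬ (∀ t t' : BTree Bool,
        pmeet (dSim dOne) (dHat dDisc ε) t t' ≤ dHat dOne ε t t') := by
  have hHat : dHat dOne ε
      (BTree.node true (BTree.node false (BTree.leaf false) (BTree.leaf false))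
        (BTree.node true (BTree.leaf true) (BTree.leaf true)))
      (BTree.node true (BTree.node false (BTree.leaf true) (BTree.leaf true))
        (BTree.node false (BTree.leaf true) (BTree.leaf true))) = 1 := by
    simp [dHat, dOne, hε1.le]
  have hMeet : pmeet (dSim dOne) (dHat dDisc ε)
      (BTree.node true (BTree.node false (BTree.leaf false) (BTree.leaf false))
        (BTree.node true (BTree.leaf true) (BTree.leaf true)))
      (BTree.node true (BTree.node false (BTree.leaf true) (BTree.leaf true))
        (BTree.node false (BTree.leaf true) (BTree.leaf true))) = ε + 1 := by
    apply le_antisymm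
    · refine (pmeet_le_add _ _ _
        (BTree.node true (BTree.node false (BTree.leaf true) (BTree.leaf true))
          (BTree.node true (BTree.leaf true) (BTree.leaf true))) _).trans ?_
      simp [dSim, dHat, dOne, dDisc, add_comm]
    · simpa [BTree.skeleton, BTree.leaves] using skeleton_add_leaves_le_pmeet ε
        (BTree.node true (BTree.node false (BTree.leaf false) (BTree.leaf false))
          (BTree.node true (BTree.leaf true) (BTree.leaf true)))
        (BTree.node true (BTree.node false (BTree.leaf true) (BTree.leaf true))
          (BTree.node false (BTree.leaf true) (BTree.leaf true)))
  refine ⟨hHat, hMeet, fun h => ?_⟩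
  have hle := hMeet.symm.le.trans ((h _ _).trans hHat.le)
  rw [add_comm] at hle
  exact (ENNReal.lt_add_right ENNReal.one_ne_top hε0.ne').not_ge hle
end
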